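/- Suppose β ∈ (0,1], ∑_{k'} ‖A^(k')‖·‖B_(k')‖ > 0, and the sampling probabilities are nearly optimal: q k ≥ β·‖A^(k)‖·‖B_(k)‖ / ∑_{k'} ‖A^(k')‖·‖B_(k')‖ for every k. Let δ ∈ (0,1) and set η = 1 + √((8/β)·log(1/δ)). Then the BasicMatrixMultiplication sketch satisfies, with probability at least 1 − δ, a squared Frobenius error bound: μ{ω : ‖A·B − CR(ω)‖_F² ≤ (η²/(β·c))·‖A‖_F²·‖B‖_F²} ≥ 1 − δ. -/

import Mathlib

open MeasureTheory

/-- Frobenius norm of a real matrix. -/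
noncomputable def frobNorm {m p : ℕ} (M : Matrix (Fin m) (Fin p) ℝ) : ℝ :=
  Real.sqrt (∑ i, ∑ j, (M i j) ^ 2)

/-- Euclidean norm of a vector. -/
noncomputable def vecNorm {m : ℕ} (v : Fin m → ℝ) : ℝ :=
  Real.sqrt (∑ i, (v i) ^ 2)

/-- The `BasicMatrixMultiplication` sketch. -/
noncomputable def CRsketch {m n p c : ℕ} (A : Matrix (Fin m) (Fin n) ℝ)
    (B : Matrix (Fin n) (Fin p) ℝ) (q : Fin n → ℝ) (ω : Fin c → Fin n) :
    Matrix (Fin m) (Fin p) ℝ :=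
  ∑ t : Fin c, (1 / ((c : ℝ) * q (ω t))) • Matrix.vecMulVec (fun i => A i (ω t)) (B (ω t))

open ProbabilityTheory
open scoped NNReal

section BoundedDifferences

variable {α : Type*} [Finite α] [MeasurableSpace α] [MeasurableSingletonClass α]

theorem integral_pi_fin_succ (ν : Measure α) [IsProbabilityMeasure ν] {c : ℕ}
    (f : (Fin (c + 1) → α) → ℝ) :
    ∫ ω, f ω ∂(Measure.pi fun _ => ν) =
      ∫ x, ∫ y, f (Fin.cons x y) ∂(Measure.pi fun _ => ν) ∂ν := by
  have h := (measurePreserving_piFinSuccAbove (fun _ : Fin (c + 1) => ν) 0).symm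
  rw [← h.integral_comp' (g := f), integral_prod _ Integrable.of_finite]
  simp only [MeasurableEquiv.piFinSuccAbove_symm_apply, Fin.insertNthEquiv_zero]
  rfl

/-- **McDiarmid's inequality** on a finite product space, in moment-generating-function form. -/
theorem hasSubgaussianMGF_pi_of_bounded_differences (ν : Measure α) [IsProbabilityMeasure ν]
    (d : ℝ≥0) {c : ℕ} (f : (Fin c → α) → ℝ)
    (hf : ∀ ω t x, |f (Function.update ω t x) - f ω| ≤ d) :
    HasSubgaussianMGF (fun ω => f ω - ∫ ω', f ω' ∂(Measure.pi fun _ => ν))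
      (c * (d / 2) ^ 2) (Measure.pi fun _ => ν) := by
  induction c with
  | zero =>
    have h : (fun ω => f ω - ∫ ω', f ω' ∂(Measure.pi fun _ : Fin 0 => ν)) = fun _ => 0 := by
      funext ω
      have : f = fun _ => f ω := funext fun ω' => congrArg f (Subsingleton.elim _ _)
      rw [this]
      simp
    rw [h]
    simp
  | succ c ih =>
    refine ⟨fun t => Integrable.of_finite, fun t => ?_⟩
    let P : Measure (Fin c → α) := Measure.pi fun _ => ν
    let g : α → ℝ := fun x => ∫ y, f (Fin.cons x y) ∂P
    have hg : ∀ x x', g x ≤ g x' + d := by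
      intro x x'
      have hint : ∫ y, f (Fin.cons x' y) + (d : ℝ) ∂P = g x' + d := by
        rw [integral_add Integrable.of_finite Integrable.of_finite]
        simp [g]
      rw [← hint]
      refine integral_mono Integrable.of_finite Integrable.of_finite fun y => ?_
      have := (abs_le.1 (hf (Fin.cons x' y) 0 x)).2
      rw [Fin.update_cons_zero] at this
      dsimp only
      linarith
    have : Nonempty α := nonempty_of_isProbabilityMeasure ν
    obtain ⟨x₀, hx₀⟩ := Finite.exists_min g
    have hG := (hasSubgaussianMGF_of_mem_Icc (X := g) (μ := ν) (a := g x₀) (b := g x₀ + d)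
      (measurable_of_finite g).aemeasurable
      (Filter.Eventually.of_forall fun x => ⟨hx₀ x, hg x x₀⟩)).mgf_le t
    have hF : ∀ x, ∫ y, Real.exp (t * (f (Fin.cons x y) - g x)) ∂P ≤
        Real.exp (((c : ℝ≥0) * (d / 2) ^ 2 : ℝ≥0) * t ^ 2 / 2) := fun x =>
      (ih (fun y => f (Fin.cons x y)) fun y s z => by
        rw [Fin.cons_update]
        exact hf _ _ _).mgf_le t
    have hm : ∫ ω, f ω ∂(Measure.pi fun _ => ν) = ∫ x, g x ∂ν := integral_pi_fin_succ ν f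
    rw [mgf, integral_pi_fin_succ, hm]
    set M := ∫ x, g x ∂ν
    calc ∫ x, ∫ y, Real.exp (t * (f (Fin.cons x y) - M)) ∂P ∂ν
        ≤ ∫ x, Real.exp (((c : ℝ≥0) * (d / 2) ^ 2 : ℝ≥0) * t ^ 2 / 2) *
            Real.exp (t * (g x - M)) ∂ν := by
          refine integral_mono Integrable.of_finite Integrable.of_finite fun x => ?_
          calc ∫ y, Real.exp (t * (f (Fin.cons x y) - M)) ∂P
              = ∫ y, Real.exp (t * (f (Fin.cons x y) - g x)) * Real.exp (t * (g x - M)) ∂P := by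
                congr 1 with y
                rw [← Real.exp_add]
                ring_nf
            _ = (∫ y, Real.exp (t * (f (Fin.cons x y) - g x)) ∂P) * Real.exp (t * (g x - M)) :=
                integral_mul_const _ _
            _ ≤ _ := mul_le_mul_of_nonneg_right (hF x) (Real.exp_nonneg _)
      _ = Real.exp (((c : ℝ≥0) * (d / 2) ^ 2 : ℝ≥0) * t ^ 2 / 2) *
            mgf (fun x => g x - M) ν t := integral_const_mul _ _
      _ ≤ Real.exp (((c : ℝ≥0) * (d / 2) ^ 2 : ℝ≥0) * t ^ 2 / 2) * _ :=
          mul_le_mul_of_nonneg_left hG (Real.exp_nonneg _)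
      _ = _ := by
          rw [← Real.exp_add]
          congr 1
          simp only [add_sub_cancel_left, NNReal.nnnorm_eq]
          push_cast
          ring

end BoundedDifferences

section FrobeniusNorm

attribute [local instance] Matrix.frobeniusNormedAddCommGroup Matrix.frobeniusNormedSpace

theorem frobNorm_eq_norm {m p : ℕ} (M : Matrix (Fin m) (Fin p) ℝ) : frobNorm M = ‖M‖ := by
  rw [frobNorm, Matrix.frobenius_norm_def, Real.sqrt_eq_rpow]
  simp

theorem abs_frobNorm_sub_frobNorm_le {m p : ℕ} (M N : Matrix (Fin m) (Fin p) ℝ) :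
    |frobNorm M - frobNorm N| ≤ frobNorm (M - N) := by
  simpa only [frobNorm_eq_norm] using abs_norm_sub_norm_le M N

theorem frobNorm_sub_le {m p : ℕ} (M N : Matrix (Fin m) (Fin p) ℝ) :
    frobNorm (M - N) ≤ frobNorm M + frobNorm N := by
  simpa only [frobNorm_eq_norm] using norm_sub_le M N

theorem frobNorm_smul {m p : ℕ} (r : ℝ) (M : Matrix (Fin m) (Fin p) ℝ) :
    frobNorm (r • M) = |r| * frobNorm M := by
  simpa only [frobNorm_eq_norm, Real.norm_eq_abs] using norm_smul r M

end FrobeniusNorm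

theorem frobNorm_sq {m p : ℕ} (M : Matrix (Fin m) (Fin p) ℝ) :
    frobNorm M ^ 2 = ∑ i, ∑ j, M i j ^ 2 :=
  Real.sq_sqrt (Finset.sum_nonneg fun _ _ => Finset.sum_nonneg fun _ _ => sq_nonneg _)

theorem vecNorm_sq {m : ℕ} (v : Fin m → ℝ) : vecNorm v ^ 2 = ∑ i, v i ^ 2 :=
  Real.sq_sqrt (Finset.sum_nonneg fun _ _ => sq_nonneg _)

theorem vecNorm_nonneg {m : ℕ} (v : Fin m → ℝ) : 0 ≤ vecNorm v := Real.sqrt_nonneg _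

theorem frobNorm_nonneg {m p : ℕ} (M : Matrix (Fin m) (Fin p) ℝ) : 0 ≤ frobNorm M :=
  Real.sqrt_nonneg _

theorem frobNorm_vecMulVec {m p : ℕ} (u : Fin m → ℝ) (v : Fin p → ℝ) :
    frobNorm (Matrix.vecMulVec u v) = vecNorm u * vecNorm v := by
  rw [← sq_eq_sq₀ (frobNorm_nonneg _) (mul_nonneg (vecNorm_nonneg _) (vecNorm_nonneg _)),
    mul_pow, frobNorm_sq, vecNorm_sq, vecNorm_sq, Finset.sum_mul_sum]
  simp only [Matrix.vecMulVec_apply, mul_pow]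

theorem sum_vecNorm_mul_vecNorm_le {m n p : ℕ} (A : Matrix (Fin m) (Fin n) ℝ)
    (B : Matrix (Fin n) (Fin p) ℝ) :
    ∑ k, vecNorm (fun i => A i k) * vecNorm (B k) ≤ frobNorm A * frobNorm B := by
  refine (Real.sum_mul_le_sqrt_mul_sqrt _ _ _).trans_eq ?_
  simp only [vecNorm_sq, frobNorm]
  rw [Finset.sum_comm]

/-- Replacing one sampled index changes the sketch by the difference of two rescaled terms. -/
theorem CRsketch_update_sub {m n p c : ℕ} (A : Matrix (Fin m) (Fin n) ℝ)
    (B : Matrix (Fin n) (Fin p) ℝ) (q : Fin n → ℝ) (ω : Fin c → Fin n) (t : Fin c) (x : Fin n) :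
    CRsketch A B q (Function.update ω t x) - CRsketch A B q ω =
      (1 / ((c : ℝ) * q x)) • Matrix.vecMulVec (fun i => A i x) (B x) -
      (1 / ((c : ℝ) * q (ω t))) • Matrix.vecMulVec (fun i => A i (ω t)) (B (ω t)) := by
  rw [CRsketch, CRsketch, ← Finset.sum_sub_distrib, Finset.sum_eq_single t]
  · simp
  · intro s _ hs
    simp [Function.update_of_ne hs]
  · simp

theorem integral_eq_sum_of_singleton {n : ℕ} {q : Fin n → ℝ} (hq : ∀ k, 0 < q k)
    {ν : Measure (Fin n)} [IsProbabilityMeasure ν]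
    (hν : ∀ k, ν {k} = ENNReal.ofReal (q k)) (f : Fin n → ℝ) :
    ∫ k, f k ∂ν = ∑ k, q k * f k := by
  rw [integral_fintype Integrable.of_finite]
  simp [measureReal_def, hν, ENNReal.toReal_ofReal (hq _).le]

/-- Second moment bound for a rescaled i.i.d. sum estimating `∑ k, z k`. -/
theorem integral_sq_sub_sum_le {n c : ℕ} (hc : 0 < c) {q : Fin n → ℝ} (hq : ∀ k, 0 < q k)
    {ν : Measure (Fin n)} [IsProbabilityMeasure ν]
    (hν : ∀ k, ν {k} = ENNReal.ofReal (q k)) (z : Fin n → ℝ) :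
    ∫ ω, (∑ k, z k - ∑ t : Fin c, 1 / ((c : ℝ) * q (ω t)) * z (ω t)) ^ 2
        ∂(Measure.pi fun _ => ν) ≤ ∑ k, z k ^ 2 / (c * q k) := by
  have hc' : (c : ℝ) ≠ 0 := by positivity
  let Y : Fin n → ℝ := fun k => 1 / ((c : ℝ) * q k) * z k
  let X : (Fin c → Fin n) → ℝ := ∑ t : Fin c, fun ω => Y (ω t)
  have hX : ∀ ω, X ω = ∑ t : Fin c, Y (ω t) := fun ω => by simp [X]
  have hYm : MemLp Y 2 ν := MemLp.of_discrete
  have hmean : ∫ ω, X ω ∂(Measure.pi fun _ => ν) = ∑ k, z k := by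
    simp only [hX]
    rw [integral_finsetSum _ fun _ _ => Integrable.of_finite]
    have h1 : ∀ t : Fin c, ∫ ω : Fin c → Fin n, Y (ω t) ∂(Measure.pi fun _ => ν) =
        (∑ k, z k) / c := by
      intro t
      rw [integral_comp_eval (μ := fun _ : Fin c => ν) (i := t) (f := Y)
        hYm.aestronglyMeasurable, integral_eq_sum_of_singleton hq hν, Finset.sum_div]
      refine Finset.sum_congr rfl fun k _ => ?_
      have := (hq k).ne'
      simp only [Y]
      field_simp
    simp only [h1]
    simp
    field_simp
  have hvar : ∫ ω, (∑ k, z k - ∑ t : Fin c, 1 / ((c : ℝ) * q (ω t)) * z (ω t)) ^ 2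
        ∂(Measure.pi fun _ => ν) = Var[X; Measure.pi fun _ => ν] := by
    rw [variance_eq_integral (measurable_of_finite X).aemeasurable, hmean]
    congr 1 with ω
    rw [hX, ← neg_sq, neg_sub]
  rw [hvar, variance_sum_pi (fun _ => hYm)]
  calc ∑ _t : Fin c, Var[Y; ν] ≤ ∑ _t : Fin c, ∑ k, q k * Y k ^ 2 := by
        refine Finset.sum_le_sum fun _ _ => ?_
        refine (variance_le_expectation_sq hYm.aestronglyMeasurable).trans_eq ?_
        exact integral_eq_sum_of_singleton hq hν _
    _ = _ := by
        rw [Finset.sum_const, Finset.card_univ, Fintype.card_fin, nsmul_eq_mul, Finset.mul_sum]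
        refine Finset.sum_congr rfl fun k _ => ?_
        have := (hq k).ne'
        simp only [Y]
        field_simp

theorem integral_frobNorm_sub_CRsketch_sq_le {m n p c : ℕ} (hc : 0 < c)
    (A : Matrix (Fin m) (Fin n) ℝ) (B : Matrix (Fin n) (Fin p) ℝ)
    {q : Fin n → ℝ} (hq : ∀ k, 0 < q k) {ν : Measure (Fin n)} [IsProbabilityMeasure ν]
    (hν : ∀ k, ν {k} = ENNReal.ofReal (q k)) :
    ∫ ω, frobNorm (A * B - CRsketch (c := c) A B q ω) ^ 2 ∂(Measure.pi fun _ => ν) ≤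
      ∑ k, (vecNorm (fun i => A i k) * vecNorm (B k)) ^ 2 / (c * q k) := by
  have hent : ∀ (ω : Fin c → Fin n) i j, (A * B - CRsketch A B q ω) i j =
      ∑ k, A i k * B k j - ∑ t, 1 / ((c : ℝ) * q (ω t)) * (A i (ω t) * B (ω t) j) := by
    intro ω i j
    simp [CRsketch, Matrix.sum_apply, Matrix.mul_apply, Matrix.vecMulVec_apply]
  simp only [frobNorm_sq, hent]
  rw [integral_finsetSum _ fun _ _ => Integrable.of_finite]
  calc _ ≤ ∑ i, ∑ j, ∑ k, (A i k * B k j) ^ 2 / (c * q k) := by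
        refine Finset.sum_le_sum fun i _ => ?_
        rw [integral_finsetSum _ fun _ _ => Integrable.of_finite]
        exact Finset.sum_le_sum fun j _ =>
          integral_sq_sub_sum_le hc hq hν fun k => A i k * B k j
    _ = ∑ k, ∑ i, ∑ j, (A i k * B k j) ^ 2 / (c * q k) := by
        rw [Finset.sum_comm (s := (Finset.univ : Finset (Fin n)))]
        exact Finset.sum_congr rfl fun i _ => Finset.sum_comm
    _ = _ := by
        refine Finset.sum_congr rfl fun k _ => ?_
        rw [mul_pow, vecNorm_sq, vecNorm_sq, Finset.sum_mul_sum, Finset.sum_div]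
        simp only [mul_pow, Finset.sum_div]

theorem stmt_4 {m n p c : ℕ} (hm : 0 < m) (hn : 0 < n) (hp : 0 < p) (hc : 0 < c)
    (A : Matrix (Fin m) (Fin n) ℝ) (B : Matrix (Fin n) (Fin p) ℝ)
    (q : Fin n → ℝ) (hq : ∀ k, 0 < q k) (hq1 : ∑ k, q k = 1)
    (ν : Measure (Fin n)) [IsProbabilityMeasure ν]
    (hν : ∀ k, ν {k} = ENNReal.ofReal (q k))
    (μ : Measure (Fin c → Fin n)) (hμ : μ = Measure.pi fun _ => ν)
    (β : ℝ) (hβ : β ∈ Set.Ioc (0 : ℝ) 1)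
    (hsum : 0 < ∑ k', vecNorm (fun i => A i k') * vecNorm (B k'))
    (hnearopt : ∀ k, q k ≥ β * (vecNorm (fun i => A i k) * vecNorm (B k)) /
        ∑ k', vecNorm (fun i => A i k') * vecNorm (B k'))
    (δ : ℝ) (hδ : δ ∈ Set.Ioo (0 : ℝ) 1)
    (η : ℝ) (hη : η = 1 + Real.sqrt ((8 / β) * Real.log (1 / δ))) :
    μ {ω | frobNorm (A * B - CRsketch A B q ω) ^ 2 ≤
        (η ^ 2 / (β * (c : ℝ))) * frobNorm A ^ 2 * frobNorm B ^ 2}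
      ≥ ENNReal.ofReal (1 - δ) := by
  subst hμ
  obtain ⟨hβ0, -⟩ := hβ
  obtain ⟨hδ0, hδ1⟩ := hδ
  set S := ∑ k', vecNorm (fun i => A i k') * vecNorm (B k') with hS
  have hc' : (0 : ℝ) < c := by exact_mod_cast hc
  have hratio : ∀ k, vecNorm (fun i => A i k) * vecNorm (B k) / q k ≤ S / β := by
    intro k
    have h := hnearopt k
    rw [ge_iff_le, div_le_iff₀ hsum] at h
    rw [div_le_div_iff₀ (hq k) hβ0]
    linarith
  let P : Measure (Fin c → Fin n) := Measure.pi fun _ => ν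
  let f : (Fin c → Fin n) → ℝ := fun ω => frobNorm (A * B - CRsketch A B q ω)
  have hterm : ∀ k, frobNorm ((1 / ((c : ℝ) * q k)) • Matrix.vecMulVec (fun i => A i k) (B k)) ≤
      S / (β * c) := by
    intro k
    have hqk := hq k
    rw [frobNorm_smul, frobNorm_vecMulVec, abs_of_pos (by positivity)]
    calc _ = vecNorm (fun i => A i k) * vecNorm (B k) / q k / c := by field_simp
      _ ≤ S / β / c := div_le_div_of_nonneg_right (hratio k) hc'.le
      _ = _ := by rw [div_div]
  obtain ⟨d, hd⟩ : ∃ d : ℝ≥0, (d : ℝ) = 2 * (S / (β * c)) :=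
    CanLift.prf (2 * (S / (β * c))) (by positivity)
  have hbd : ∀ ω t x, |f (Function.update ω t x) - f ω| ≤ d := by
    intro ω t x
    rw [abs_sub_comm]
    refine (abs_frobNorm_sub_frobNorm_le _ _).trans ?_
    rw [sub_sub_sub_cancel_left, CRsketch_update_sub]
    refine (frobNorm_sub_le _ _).trans ?_
    rw [hd, two_mul]
    exact add_le_add (hterm _) (hterm _)
  have hsecond : ∫ ω, f ω ^ 2 ∂P ≤ S ^ 2 / (β * c) := by
    refine (integral_frobNorm_sub_CRsketch_sq_le hc A B hq hν).trans ?_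
    calc _ ≤ ∑ k, vecNorm (fun i => A i k) * vecNorm (B k) * (S / β / c) := by
          refine Finset.sum_le_sum fun k _ => ?_
          have hqk := hq k
          calc _ = vecNorm (fun i => A i k) * vecNorm (B k) *
                (vecNorm (fun i => A i k) * vecNorm (B k) / q k / c) := by field_simp
            _ ≤ _ := by
                refine mul_le_mul_of_nonneg_left ?_
                  (mul_nonneg (vecNorm_nonneg _) (vecNorm_nonneg _))
                exact div_le_div_of_nonneg_right (hratio k) hc'.le
      _ = _ := by
          rw [← Finset.sum_mul, ← hS]
          field_simp
  set R := S / Real.sqrt (β * c) with hR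
  have hR2 : R ^ 2 = S ^ 2 / (β * c) := by rw [hR, div_pow, Real.sq_sqrt (by positivity)]
  have hR0 : 0 < R := by positivity
  have hmean : ∫ ω, f ω ∂P ≤ R := by
    refine (sq_le_sq₀ (integral_nonneg fun _ => frobNorm_nonneg _) hR0.le).1 ?_
    have := variance_nonneg f P
    rw [variance_eq_sub MemLp.of_discrete] at this
    simp only [Pi.pow_apply] at this
    linarith
  have hlog : 0 < Real.log (1 / δ) := Real.log_pos (by rw [lt_div_iff₀ hδ0]; linarith)
  set s := Real.sqrt ((8 / β) * Real.log (1 / δ)) with hs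
  have hs2 : s ^ 2 = (8 / β) * Real.log (1 / δ) := Real.sq_sqrt (by positivity)
  have hs0 : 0 ≤ s := Real.sqrt_nonneg _
  have htail := (hasSubgaussianMGF_pi_of_bounded_differences ν _ f hbd).measure_ge_le
    (ε := R * s) (by positivity)
  have hexp : Real.exp (-(R * s) ^ 2 /
      (2 * ((c * (d / 2) ^ 2 : ℝ≥0) : ℝ))) ≤ δ := by
    have h1 : -(R * s) ^ 2 / (2 * ((c * (d / 2) ^ 2 : ℝ≥0) : ℝ)) =
        -4 * Real.log (1 / δ) := by
      push_cast
      rw [hd, mul_pow, hR2, hs2]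
      field_simp
      ring
    rw [h1]
    calc _ ≤ Real.exp (-Real.log (1 / δ)) := Real.exp_le_exp.2 (by linarith)
      _ = δ := by
        rw [one_div, Real.log_inv, neg_neg, Real.exp_log hδ0]
  have hbad := htail.trans hexp
  set T := {ω | R * s ≤ f ω - ∫ ω', f ω' ∂(Measure.pi fun _ => ν)} with hT
  have hgood : 1 - δ ≤ P.real Tᶜ := by
    rw [probReal_compl_eq_one_sub (Set.toFinite T).measurableSet]
    linarith
  rw [ge_iff_le, ENNReal.ofReal_le_iff_le_toReal (measure_ne_top _ _)]
  refine hgood.trans (measureReal_mono fun ω hω => ?_)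
  have hω' : f ω - ∫ ω', f ω' ∂P < R * s := not_le.1 hω
  have hfω : f ω ≤ η * R := by rw [hη]; linarith
  have hSAB := sum_vecNorm_mul_vecNorm_le A B
  calc f ω ^ 2 ≤ (η * R) ^ 2 := pow_le_pow_left₀ (frobNorm_nonneg _) hfω 2
    _ = η ^ 2 / (β * c) * S ^ 2 := by rw [mul_pow, hR2]; ring
    _ ≤ η ^ 2 / (β * c) * (frobNorm A * frobNorm B) ^ 2 := by gcongr
    _ = _ := by ring
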